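/- The operators T_a and T_b on H* satisfy the braid relation T_a ∘ T_b ∘ T_a = T_b ∘ T_a ∘ T_b; equivalently, the elements v_A^{-1}, v_B^{-1} of the handle algebra satisfy v_A^{-1} v_B^{-1} v_A^{-1} = v_B^{-1} v_A^{-1} v_B^{-1}, so that τ_a ↦ T_a, τ_b ↦ T_b defines a representation of the braid group B₃ = ⟨τ_a, τ_b | τ_aτ_bτ_a = τ_bτ_aτ_b⟩ (the mapping class group of the one-holed torus) on H*. -/

import Mathlib

/- STATEMENT 4: the operators `T_a`, `T_b` on `H*` satisfy the braid relation, and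
hence define a representation of `B₃ = MCG(Σ_{1,0} ∖ D)` on `H*`. -/

noncomputable section

open scoped TensorProduct
open TensorProduct

/-- Symmetric linear forms on `H`. -/
def IsSLF {H : Type} [Ring H] [Algebra ℂ H] (φ : Module.Dual ℂ H) : Prop :=
  ∀ x y : H, φ (x * y) = φ (y * x)

/-- The convolution product on the dual of a Hopf algebra: `(φψ)(x) = φ(x')ψ(x'')`. -/
def conv {H : Type} [Ring H] [HopfAlgebra ℂ H] (φ ψ : Module.Dual ℂ H) :
    Module.Dual ℂ H :=
  LinearMap.mul' ℂ ℂ ∘ₗ TensorProduct.map φ ψ ∘ₗ (Coalgebra.comul (R := ℂ) (A := H))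

/-- The operator `T_a(φ) = φ(v⁻¹ ?)`. -/
def Ta {H : Type} [Ring H] [Algebra ℂ H] (vinv : H) (φ : Module.Dual ℂ H) :
    Module.Dual ℂ H :=
  φ ∘ₗ LinearMap.mulLeft ℂ vinv

/-- The operator `T_b(φ) = μˡ(v)⁻¹·[μˡ(g⁻¹v ?)·φ(v ?)](v⁻¹ ?)`. -/
def Tb {H : Type} [Ring H] [HopfAlgebra ℂ H] (μl : Module.Dual ℂ H)
    (v vinv gi : H) (φ : Module.Dual ℂ H) : Module.Dual ℂ H :=
  (μl v)⁻¹ • ((conv (μl ∘ₗ LinearMap.mulLeft ℂ (gi * v))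
      (φ ∘ₗ LinearMap.mulLeft ℂ v)) ∘ₗ LinearMap.mulLeft ℂ vinv)

open HopfAlgebra Coalgebra WithConv

section

variable {H : Type} [Ring H] [HopfAlgebra ℂ H]

/-- The partial evaluation `x ⊗ y ↦ f(y) x`. -/
def slice : Module.Dual ℂ H →ₗ[ℂ] H ⊗[ℂ] H →ₗ[ℂ] H :=
  (TensorProduct.rid ℂ H).toLinearMap.compRight ℂ ∘ₗ LinearMap.lTensorHom H

@[simp]
lemma slice_tmul (f : Module.Dual ℂ H) (x y : H) : slice f (x ⊗ₜ[ℂ] y) = f y • x := by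
  simp [slice]

lemma slice_mul_left (f : Module.Dual ℂ H) (a b : H) (t : H ⊗[ℂ] H) :
    slice f ((a ⊗ₜ[ℂ] b) * t) = a * slice (f ∘ₗ LinearMap.mulLeft ℂ b) t := by
  induction t with
  | zero => simp
  | tmul x y => simp
  | add x y hx hy => rw [mul_add, map_add, hx, hy, map_add, mul_add]

lemma slice_mul_right (f : Module.Dual ℂ H) (a b : H) (t : H ⊗[ℂ] H) :
    slice f (t * (a ⊗ₜ[ℂ] b)) = slice (f ∘ₗ LinearMap.mulRight ℂ b) t * a := by
  induction t with
  | zero => simp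
  | tmul x y => simp
  | add x y hx hy => rw [add_mul, map_add, hx, hy, map_add, add_mul]

lemma sum_counit_right_smul (h : H) :
    ∑ i ∈ (ℛ ℂ h).index, counit (R := ℂ) ((ℛ ℂ h).right i) • (ℛ ℂ h).left i = h := by
  have := congr(TensorProduct.rid ℂ H $(sum_tmul_counit_eq (ℛ ℂ h)))
  rwa [map_sum, Finset.sum_congr rfl fun i _ => TensorProduct.rid_tmul _ _,
    TensorProduct.rid_tmul, one_smul] at this

/-- `toConv` of the map `x ↦ ε(x) a`. -/
def convConst {A : Type} [Ring A] [Algebra ℂ A] (a : A) : WithConv (H →ₗ[ℂ] A) :=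
  toConv (LinearMap.toSpanSingleton ℂ A a ∘ₗ counit)

lemma mul_convConst_apply {A : Type} [Ring A] [Algebra ℂ A] (f : WithConv (H →ₗ[ℂ] A)) (a : A)
    (h : H) : (f * convConst a : WithConv (H →ₗ[ℂ] A)) h = f h * a := by
  rw [(ℛ ℂ h).convMul_apply]
  conv_rhs => rw [← sum_counit_right_smul h]
  simp [convConst, Finset.sum_mul]

lemma convConst_mul_apply {A : Type} [Ring A] [Algebra ℂ A] (f : WithConv (H →ₗ[ℂ] A)) (a : A)
    (h : H) : (convConst a * f : WithConv (H →ₗ[ℂ] A)) h = a * f h := by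
  rw [(ℛ ℂ h).convMul_apply]
  conv_rhs => rw [← sum_counit_smul (ℛ ℂ h)]
  simp [convConst, Finset.mul_sum]

lemma convInl_mul_convInr :
    (toConv (Algebra.TensorProduct.includeLeft (R := ℂ) (S := ℂ) (A := H) (B := H)).toLinearMap *
      toConv (Algebra.TensorProduct.includeRight (R := ℂ) (A := H) (B := H)).toLinearMap :
      WithConv (H →ₗ[ℂ] H ⊗[ℂ] H)) = toConv comul := by
  ext h
  rw [(ℛ ℂ h).convMul_apply]
  simp [← (ℛ ℂ h).eq]

lemma convInl_antipode_mul_comul :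
    (toConv ((Algebra.TensorProduct.includeLeft (R := ℂ) (S := ℂ) (A := H) (B := H)).toLinearMap
        ∘ₗ antipode ℂ) * toConv comul : WithConv (H →ₗ[ℂ] H ⊗[ℂ] H)) =
      toConv (Algebra.TensorProduct.includeRight (R := ℂ) (A := H) (B := H)).toLinearMap := by
  rw [← convInl_mul_convInr, ← mul_assoc]
  convert one_mul _
  ext h
  rw [(ℛ ℂ h).convMul_apply]
  simp [← TensorProduct.sum_tmul, sum_antipode_mul_eq_smul, Algebra.algebraMap_eq_smul_one,
    Algebra.TensorProduct.one_def, TensorProduct.smul_tmul']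

lemma comul_mul_convInr_antipode :
    (toConv comul * toConv ((Algebra.TensorProduct.includeRight
        (R := ℂ) (A := H) (B := H)).toLinearMap ∘ₗ antipode ℂ) : WithConv (H →ₗ[ℂ] H ⊗[ℂ] H)) =
      toConv (Algebra.TensorProduct.includeLeft (R := ℂ) (S := ℂ) (A := H) (B := H)).toLinearMap
      := by
  rw [← convInl_mul_convInr, mul_assoc]
  convert mul_one _
  ext h
  rw [(ℛ ℂ h).convMul_apply]
  simp [← TensorProduct.tmul_sum, sum_mul_antipode_eq_smul, Algebra.algebraMap_eq_smul_one,
    Algebra.TensorProduct.one_def]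

lemma one_tmul_eq_sum (a : H) :
    1 ⊗ₜ[ℂ] a = ∑ i ∈ (ℛ ℂ a).index,
      (antipode ℂ ((ℛ ℂ a).left i) ⊗ₜ[ℂ] 1) * comul (R := ℂ) ((ℛ ℂ a).right i) := by
  have := congr($(convInl_antipode_mul_comul (H := H)) a)
  rw [(ℛ ℂ a).convMul_apply] at this
  simpa using this.symm

/-- If `X` commutes with the coproduct, the adjoint action of `h` on the second leg of `X`
can be moved to the first leg. -/
lemma sum_one_tmul_mul_mul_one_tmul_antipode (X : H ⊗[ℂ] H)
    (hX : ∀ h : H, X * comul (R := ℂ) h = comul (R := ℂ) h * X) (h : H) :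
    ∑ i ∈ (ℛ ℂ h).index, (1 ⊗ₜ[ℂ] (ℛ ℂ h).left i) * X * (1 ⊗ₜ[ℂ] antipode ℂ ((ℛ ℂ h).right i)) =
      ∑ i ∈ (ℛ ℂ h).index, (antipode ℂ ((ℛ ℂ h).left i) ⊗ₜ[ℂ] 1) * X *
        ((ℛ ℂ h).right i ⊗ₜ[ℂ] 1) := by
  have hc : (toConv comul * convConst X :
      WithConv (H →ₗ[ℂ] H ⊗[ℂ] H)) =
      convConst X * toConv comul := by
    ext h
    rw [mul_convConst_apply, convConst_mul_apply]
    exact (hX h).symm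
  have key := congr($(convInl_antipode_mul_comul (H := H)) * convConst X * toConv
    ((Algebra.TensorProduct.includeRight (R := ℂ) (A := H) (B := H)).toLinearMap ∘ₗ antipode ℂ))
  rw [mul_assoc (G := WithConv (H →ₗ[ℂ] H ⊗[ℂ] H)) _ (toConv comul) (convConst X), hc,
    ← mul_assoc,
    mul_assoc (G := WithConv (H →ₗ[ℂ] H ⊗[ℂ] H)) _ (toConv comul) _,
    comul_mul_convInr_antipode] at key
  have := congr($key h)
  rw [(ℛ ℂ h).convMul_apply, (ℛ ℂ h).convMul_apply] at this
  simp only [mul_convConst_apply] at this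
  simpa using this.symm

/-- A functional whose slice of a nondegenerate `X` commuting with the coproduct is central is
cyclic up to the square of the antipode. -/
lemma apply_mul_eq_apply_mul_antipode_antipode (X : H ⊗[ℂ] H)
    (hX : ∀ h : H, X * comul (R := ℂ) h = comul (R := ℂ) h * X)
    (hinj : Function.Injective fun β : Module.Dual ℂ H => slice β X)
    (φ : Module.Dual ℂ H) (hφ : ∀ h : H, h * slice φ X = slice φ X * h) (h x : H) :
    φ (h * x) = φ (x * antipode ℂ (antipode ℂ h)) := by
  have twist (h y : H) : ∑ i ∈ (ℛ ℂ h).index,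
      φ ((ℛ ℂ h).left i * y * antipode ℂ ((ℛ ℂ h).right i)) = counit (R := ℂ) h * φ y := by
    have : ∑ i ∈ (ℛ ℂ h).index, (φ ∘ₗ
        LinearMap.mulRight ℂ (antipode ℂ ((ℛ ℂ h).right i))) ∘ₗ
          LinearMap.mulLeft ℂ ((ℛ ℂ h).left i) = counit (R := ℂ) h • φ := by
      apply hinj
      have key := congr(slice φ $(sum_one_tmul_mul_mul_one_tmul_antipode X hX h))
      simp only [map_sum, slice_mul_right, slice_mul_left] at key
      simp only [map_sum, LinearMap.sum_apply, map_smul, LinearMap.smul_apply]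
      simp only [one_mul, mul_one, LinearMap.mulLeft_one, LinearMap.mulRight_one,
        LinearMap.comp_id, mul_assoc, ← hφ] at key
      simp only [← mul_assoc, ← Finset.sum_mul, sum_antipode_mul_eq_smul] at key
      rw [key, smul_mul_assoc, one_mul]
    simpa using congr($this y)
  have co := congr((φ ∘ₗ LinearMap.mul' ℂ H ∘ₗ TensorProduct.map (LinearMap.mulRight ℂ x)
    (antipode ℂ ∘ₗ LinearMap.mul' ℂ H ∘ₗ LinearMap.lTensor H (antipode ℂ)))
    $(sum_tmul_tmul_eq (ℛ ℂ h) (fun i => ℛ ℂ _) (fun i => ℛ ℂ _)))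
  simp only [map_sum, LinearMap.comp_apply, TensorProduct.map_tmul, LinearMap.lTensor_tmul,
    LinearMap.mul'_apply, LinearMap.mulRight_apply] at co
  simp only [← map_sum, ← Finset.mul_sum, sum_mul_antipode_eq_smul] at co
  simp only [antipode_mul_antidistrib, map_sum, ← mul_assoc] at co
  simp only [mul_assoc _ x, twist] at co
  have hl : ∑ i ∈ (ℛ ℂ h).index, counit (R := ℂ) ((ℛ ℂ h).left i) *
      φ (x * antipode ℂ (antipode ℂ ((ℛ ℂ h).right i))) =
      φ (x * antipode ℂ (antipode ℂ h)) := by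
    conv_rhs => rw [← sum_counit_smul (ℛ ℂ h)]
    simp [Finset.mul_sum]
  have hr : ∑ i ∈ (ℛ ℂ h).index, (ℛ ℂ h).left i *
      (x * antipode ℂ (counit (R := ℂ) ((ℛ ℂ h).right i) • 1)) = h * x := by
    conv_rhs => rw [← sum_counit_right_smul h]
    simp [Finset.sum_mul, antipode_one]
  rw [hl, ← map_sum, hr] at co
  exact co.symm

end

section

variable {H : Type} [Ring H] [HopfAlgebra ℂ H] {ι : Type} [Fintype ι] {aR bR : ι → H}

lemma sum_counit_smul_of_comul_tmul (hRinv : IsUnit (∑ i, aR i ⊗ₜ[ℂ] bR i : H ⊗[ℂ] H))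
    (hR₁ : (∑ i, (comul (R := ℂ) (aR i)) ⊗ₜ[ℂ] bR i)
        = ∑ i, ∑ j, (aR i ⊗ₜ[ℂ] aR j) ⊗ₜ[ℂ] (bR i * bR j)) :
    ∑ i, counit (R := ℂ) (aR i) • bR i = 1 := by
  have key := congr(LinearMap.rTensor H ((TensorProduct.lid ℂ H).toLinearMap ∘ₗ
    LinearMap.rTensor H counit) $hR₁)
  simp only [map_sum, LinearMap.rTensor_tmul, LinearMap.comp_apply, rTensor_counit_comul,
    LinearEquiv.coe_coe, TensorProduct.lid_tmul, one_smul] at key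
  have h1 : (1 ⊗ₜ[ℂ] ∑ i, counit (R := ℂ) (aR i) • bR i : H ⊗[ℂ] H) = 1 := by
    refine hRinv.mul_right_cancel ?_
    rw [one_mul]
    conv_rhs => rw [key]
    simp [TensorProduct.tmul_sum, Finset.sum_mul, Finset.mul_sum, TensorProduct.smul_tmul']
    exact Finset.sum_comm
  simpa [Algebra.TensorProduct.one_def] using
    congr(TensorProduct.lid ℂ H (LinearMap.rTensor H counit $h1))

lemma sum_counit_smul_of_tmul_comul (hRinv : IsUnit (∑ i, aR i ⊗ₜ[ℂ] bR i : H ⊗[ℂ] H))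
    (hR₂ : (∑ i, aR i ⊗ₜ[ℂ] (comul (R := ℂ) (bR i)))
        = ∑ i, ∑ j, (aR i * aR j) ⊗ₜ[ℂ] (bR j ⊗ₜ[ℂ] bR i)) :
    ∑ i, counit (R := ℂ) (bR i) • aR i = 1 := by
  have key := congr(LinearMap.lTensor H ((TensorProduct.lid ℂ H).toLinearMap ∘ₗ
    LinearMap.rTensor H counit) $hR₂)
  simp only [map_sum, LinearMap.rTensor_tmul, LinearMap.lTensor_tmul, LinearMap.comp_apply,
    rTensor_counit_comul, LinearEquiv.coe_coe, TensorProduct.lid_tmul, one_smul] at key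
  have h1 : ((∑ i, counit (R := ℂ) (bR i) • aR i) ⊗ₜ[ℂ] 1 : H ⊗[ℂ] H) = 1 := by
    refine hRinv.mul_left_cancel ?_
    rw [mul_one]
    conv_rhs => rw [key]
    simp [TensorProduct.sum_tmul, Finset.sum_mul, Finset.mul_sum, TensorProduct.smul_tmul']
    exact Finset.sum_comm
  simpa [Algebra.TensorProduct.one_def] using
    congr(TensorProduct.rid ℂ H (LinearMap.lTensor H counit $h1))

lemma sum_tmul_antipode_mul_sum_tmul (hRinv : IsUnit (∑ i, aR i ⊗ₜ[ℂ] bR i : H ⊗[ℂ] H))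
    (hR₁ : (∑ i, (comul (R := ℂ) (aR i)) ⊗ₜ[ℂ] bR i)
        = ∑ i, ∑ j, (aR i ⊗ₜ[ℂ] aR j) ⊗ₜ[ℂ] (bR i * bR j)) :
    (∑ i, bR i ⊗ₜ[ℂ] antipode ℂ (aR i)) * (∑ i, bR i ⊗ₜ[ℂ] aR i) = 1 := by
  have key := congr(TensorProduct.comm ℂ H H (LinearMap.rTensor H (LinearMap.mul' ℂ H ∘ₗ
    LinearMap.rTensor H (antipode ℂ)) $hR₁))
  simp only [map_sum, LinearMap.rTensor_tmul, LinearMap.comp_apply,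
    mul_antipode_rTensor_comul_apply, TensorProduct.comm_tmul, LinearMap.mul'_apply,
    Algebra.algebraMap_eq_smul_one, ← TensorProduct.smul_tmul, ← TensorProduct.sum_tmul,
    sum_counit_smul_of_comul_tmul hRinv hR₁] at key
  simp only [Finset.sum_mul_sum, Algebra.TensorProduct.tmul_mul_tmul, ← key,
    Algebra.TensorProduct.one_def]

lemma mul_rTensor_comm_comul {Sinv : H →ₗ[ℂ] H}
    (hSinv₁ : ∀ x : H, Sinv (antipode ℂ x) = x) (hSinv₂ : ∀ x : H, antipode ℂ (Sinv x) = x)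
    (x : H) :
    LinearMap.mul' ℂ H (LinearMap.rTensor H Sinv (TensorProduct.comm ℂ H H (comul (R := ℂ) x))) =
      counit (R := ℂ) x • 1 := by
  refine Function.LeftInverse.injective hSinv₁ ?_
  rw [← (ℛ ℂ x).eq]
  simp [antipode_mul_antidistrib, hSinv₂, sum_antipode_mul_eq_smul]

lemma mul_lTensor_comm_comul {Sinv : H →ₗ[ℂ] H}
    (hSinv₁ : ∀ x : H, Sinv (antipode ℂ x) = x) (hSinv₂ : ∀ x : H, antipode ℂ (Sinv x) = x)
    (x : H) :
    LinearMap.mul' ℂ H (LinearMap.lTensor H Sinv (TensorProduct.comm ℂ H H (comul (R := ℂ) x))) =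
      counit (R := ℂ) x • 1 := by
  refine Function.LeftInverse.injective hSinv₁ ?_
  rw [← (ℛ ℂ x).eq]
  simp [antipode_mul_antidistrib, hSinv₂, sum_mul_antipode_eq_smul]

lemma sum_tmul_antipode_inv_mul_sum_tmul {Sinv : H →ₗ[ℂ] H}
    (hSinv₁ : ∀ x : H, Sinv (antipode ℂ x) = x) (hSinv₂ : ∀ x : H, antipode ℂ (Sinv x) = x)
    (hRinv : IsUnit (∑ i, aR i ⊗ₜ[ℂ] bR i : H ⊗[ℂ] H))
    (hR₂ : (∑ i, aR i ⊗ₜ[ℂ] (comul (R := ℂ) (bR i)))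
        = ∑ i, ∑ j, (aR i * aR j) ⊗ₜ[ℂ] (bR j ⊗ₜ[ℂ] bR i)) :
    (∑ i, aR i ⊗ₜ[ℂ] Sinv (bR i)) * (∑ i, aR i ⊗ₜ[ℂ] bR i) = 1 := by
  have key := congr(LinearMap.lTensor H (LinearMap.mul' ℂ H ∘ₗ
    LinearMap.rTensor H Sinv ∘ₗ (TensorProduct.comm ℂ H H).toLinearMap) $hR₂)
  simp only [map_sum, LinearMap.lTensor_tmul, LinearMap.rTensor_tmul, LinearMap.comp_apply,
    LinearEquiv.coe_coe, mul_rTensor_comm_comul hSinv₁ hSinv₂, TensorProduct.comm_tmul,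
    LinearMap.mul'_apply, ← TensorProduct.smul_tmul, ← TensorProduct.sum_tmul,
    sum_counit_smul_of_tmul_comul hRinv hR₂] at key
  simp only [Finset.sum_mul_sum, Algebra.TensorProduct.tmul_mul_tmul, ← key,
    Algebra.TensorProduct.one_def]

/-- The monodromy matrix commutes with the coproduct. -/
lemma monodromy_mul_comul
    (hRΔ : ∀ x : H, (∑ i, aR i ⊗ₜ[ℂ] bR i) * comul (R := ℂ) x
        = (TensorProduct.comm ℂ H H) (comul (R := ℂ) x) * ∑ i, aR i ⊗ₜ[ℂ] bR i) (x : H) :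
    ((∑ i, bR i ⊗ₜ[ℂ] aR i) * ∑ i, aR i ⊗ₜ[ℂ] bR i) * comul (R := ℂ) x =
      comul (R := ℂ) x * ((∑ i, bR i ⊗ₜ[ℂ] aR i) * ∑ i, aR i ⊗ₜ[ℂ] bR i) := by
  have hc := congr(Algebra.TensorProduct.comm ℂ H H $(hRΔ x))
  have hcomm (t : H ⊗[ℂ] H) : Algebra.TensorProduct.comm ℂ H H (TensorProduct.comm ℂ H H t) = t :=
    (TensorProduct.comm ℂ H H).symm_apply_apply t
  simp only [map_mul, map_sum, Algebra.TensorProduct.comm_tmul, hcomm] at hc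
  rw [mul_assoc, hRΔ, ← mul_assoc, ← mul_assoc, ← hc]
  rfl

lemma sum_apply_antipode_monodromy {Sinv : H →ₗ[ℂ] H}
    (hSinv₁ : ∀ x : H, Sinv (antipode ℂ x) = x) (hSinv₂ : ∀ x : H, antipode ℂ (Sinv x) = x)
    (hRinv : IsUnit (∑ i, aR i ⊗ₜ[ℂ] bR i : H ⊗[ℂ] H))
    (hR₁ : (∑ i, (comul (R := ℂ) (aR i)) ⊗ₜ[ℂ] bR i)
        = ∑ i, ∑ j, (aR i ⊗ₜ[ℂ] aR j) ⊗ₜ[ℂ] (bR i * bR j))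
    (hR₂ : (∑ i, aR i ⊗ₜ[ℂ] (comul (R := ℂ) (bR i)))
        = ∑ i, ∑ j, (aR i * aR j) ⊗ₜ[ℂ] (bR j ⊗ₜ[ℂ] bR i))
    {v vinv : H} (hv : v * vinv = 1) (hvcentral : ∀ x : H, v * x = x * v)
    (hΔv : (∑ i, bR i ⊗ₜ[ℂ] aR i) * ((∑ i, aR i ⊗ₜ[ℂ] bR i) * comul (R := ℂ) v) = v ⊗ₜ[ℂ] v)
    {μl : Module.Dual ℂ H} (hμv : slice μl (comul (R := ℂ) v) = μl v • 1)
    (hcyc : ∀ x y : H, μl (x * y) = μl (y * antipode ℂ (antipode ℂ x))) :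
    ∑ i, ∑ j, μl (v * antipode ℂ (bR i * aR j)) • (aR i * bR j) = μl v • vinv := by
  have hΔ : comul (R := ℂ) v = (∑ i, aR i ⊗ₜ[ℂ] Sinv (bR i)) *
      ((∑ i, bR i ⊗ₜ[ℂ] antipode ℂ (aR i)) * (v ⊗ₜ[ℂ] v)) := by
    rw [← hΔv, ← mul_assoc (∑ i, bR i ⊗ₜ[ℂ] antipode ℂ (aR i)),
      sum_tmul_antipode_mul_sum_tmul hRinv hR₁, one_mul, ← mul_assoc,
      sum_tmul_antipode_inv_mul_sum_tmul hSinv₁ hSinv₂ hRinv hR₂, one_mul]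
  rw [hΔ] at hμv
  simp only [Finset.sum_mul, Finset.mul_sum, Algebra.TensorProduct.tmul_mul_tmul, map_sum,
    slice_tmul] at hμv
  have h := congr($hμv * vinv)
  simp only [Finset.sum_mul, smul_mul_assoc, mul_assoc, hv, mul_one, one_mul] at h
  rw [← h, Finset.sum_comm]
  refine Finset.sum_congr rfl fun i _ => Finset.sum_congr rfl fun j _ => ?_
  rw [hcyc (Sinv _), hSinv₂, antipode_mul_antidistrib, ← mul_assoc, hvcentral]

end

section

variable {H : Type} [Ring H] [HopfAlgebra ℂ H]

/-- The convolution product twisted by an element of `H ⊗ H` acting on the left. -/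
def convWith (t : H ⊗[ℂ] H) (φ ψ : Module.Dual ℂ H) : Module.Dual ℂ H :=
  LinearMap.mul' ℂ ℂ ∘ₗ TensorProduct.map φ ψ ∘ₗ LinearMap.mulLeft ℂ t ∘ₗ
    (comul (R := ℂ) (A := H))

lemma convWith_one (φ ψ : Module.Dual ℂ H) : convWith 1 φ ψ = conv φ ψ := by
  simp [convWith, conv]

lemma convWith_zero (φ ψ : Module.Dual ℂ H) : convWith 0 φ ψ = 0 := by
  ext x; simp [convWith]

lemma convWith_add (s t : H ⊗[ℂ] H) (φ ψ : Module.Dual ℂ H) :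
    convWith (s + t) φ ψ = convWith s φ ψ + convWith t φ ψ := by
  ext x; simp [convWith, add_mul]

lemma convWith_smul (c : ℂ) (t : H ⊗[ℂ] H) (φ ψ : Module.Dual ℂ H) :
    convWith (c • t) φ ψ = c • convWith t φ ψ := by
  ext x; simp [convWith]

lemma mul'_map_tmul_mul (a b : H) (t : H ⊗[ℂ] H) (φ ψ : Module.Dual ℂ H) :
    LinearMap.mul' ℂ ℂ (TensorProduct.map φ ψ ((a ⊗ₜ[ℂ] b) * t)) =
      LinearMap.mul' ℂ ℂ (TensorProduct.map (φ ∘ₗ LinearMap.mulLeft ℂ a)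
        (ψ ∘ₗ LinearMap.mulLeft ℂ b) t) := by
  induction t with
  | zero => simp
  | tmul x y => simp
  | add x y hx hy => simp only [mul_add, map_add, hx, hy]

lemma convWith_tmul_mul (a b : H) (t : H ⊗[ℂ] H) (φ ψ : Module.Dual ℂ H) :
    convWith ((a ⊗ₜ[ℂ] b) * t) φ ψ =
      convWith t (φ ∘ₗ LinearMap.mulLeft ℂ a) (ψ ∘ₗ LinearMap.mulLeft ℂ b) := by
  ext x
  simp only [convWith, LinearMap.comp_apply, LinearMap.mulLeft_apply, mul_assoc,
    mul'_map_tmul_mul]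

lemma conv_comp_mulLeft {a : H} {t : H ⊗[ℂ] H} (ha : comul (R := ℂ) a = t)
    (φ ψ : Module.Dual ℂ H) : conv φ ψ ∘ₗ LinearMap.mulLeft ℂ a = convWith t φ ψ := by
  ext x
  simp [conv, convWith, ha]

lemma conv_assoc (φ ψ χ : Module.Dual ℂ H) : conv (conv φ ψ) χ = conv φ (conv ψ χ) :=
  congr(ofConv $(mul_assoc (toConv φ) (toConv ψ) (toConv χ)))

lemma conv_apply (φ ψ : Module.Dual ℂ H) (x : H) :
    conv φ ψ x = φ (slice ψ (comul (R := ℂ) x)) := by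
  simp only [conv, LinearMap.comp_apply]
  induction comul (R := ℂ) x with
  | zero => simp
  | tmul x y => simp [mul_comm]
  | add x y hx hy => simp only [map_add, hx, hy]

/-- Convolution on the left as a linear map. -/
def convLeft (φ : Module.Dual ℂ H) : Module.End ℂ (Module.Dual ℂ H) where
  toFun := conv φ
  map_add' ψ χ := by ext x; simp [conv, TensorProduct.map_add_right]
  map_smul' c ψ := by ext x; simp [conv, TensorProduct.map_smul_right]

lemma convLeft_apply (φ ψ : Module.Dual ℂ H) : convLeft φ ψ = conv φ ψ := rfl

/-- The map sending `p` to the contraction of `φ ∘ S` with the first leg of `Δ(p)`. -/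
def antipodeContract (φ : Module.Dual ℂ H) : H →ₗ[ℂ] H :=
  (TensorProduct.lid ℂ H).toLinearMap ∘ₗ LinearMap.rTensor H (φ ∘ₗ antipode ℂ) ∘ₗ
    comul (R := ℂ)

lemma antipodeContract_apply (φ : Module.Dual ℂ H) (a : H) :
    antipodeContract φ a = ∑ i ∈ (ℛ ℂ a).index,
      φ (antipode ℂ ((ℛ ℂ a).left i)) • (ℛ ℂ a).right i := by
  rw [antipodeContract, LinearMap.comp_apply, LinearMap.comp_apply]
  conv_lhs => rw [← (ℛ ℂ a).eq]
  simp

variable {μl : Module.Dual ℂ H}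

lemma slice_comp_mulLeft_comul (hμ : ∀ x : H, slice μl (comul (R := ℂ) x) = μl x • 1) (a x : H) :
    slice (μl ∘ₗ LinearMap.mulLeft ℂ a) (comul (R := ℂ) x) =
      ∑ i ∈ (ℛ ℂ a).index, μl ((ℛ ℂ a).right i * x) • antipode ℂ ((ℛ ℂ a).left i) := by
  have h := slice_mul_left μl 1 a (comul (R := ℂ) x)
  rw [one_mul] at h
  rw [← h, one_tmul_eq_sum, Finset.sum_mul, map_sum]
  refine Finset.sum_congr rfl fun i _ => ?_
  rw [mul_assoc, ← Bialgebra.comul_mul, slice_mul_left, LinearMap.mulLeft_one,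
    LinearMap.comp_id, hμ, mul_smul_comm, mul_one]

lemma conv_comp_mulLeft_right (hμ : ∀ x : H, slice μl (comul (R := ℂ) x) = μl x • 1)
    (φ : Module.Dual ℂ H) (a : H) :
    conv φ (μl ∘ₗ LinearMap.mulLeft ℂ a) =
      μl ∘ₗ LinearMap.mulLeft ℂ (antipodeContract φ a) := by
  ext x
  rw [conv_apply, slice_comp_mulLeft_comul hμ, antipodeContract_apply]
  simp [Finset.sum_mul, mul_comm]

lemma conv_convWith (hμ : ∀ x : H, slice μl (comul (R := ℂ) x) = μl x • 1)
    (φ ψ : Module.Dual ℂ H) (t : H ⊗[ℂ] H) :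
    conv φ (convWith t μl ψ) = convWith (LinearMap.rTensor H (antipodeContract φ) t) μl ψ := by
  change convLeft φ _ = _
  induction t with
  | zero => simp [convWith_zero]
  | tmul p k =>
    rw [LinearMap.rTensor_tmul, ← mul_one (p ⊗ₜ[ℂ] k), ← mul_one (antipodeContract φ p ⊗ₜ[ℂ] k),
      convWith_tmul_mul, convWith_tmul_mul, convWith_one, convWith_one, convLeft_apply,
      ← conv_assoc, conv_comp_mulLeft_right hμ]
  | add x y hx hy => rw [convWith_add, map_add, hx, hy, map_add, convWith_add]

/-- A left integral is a nondegenerate functional. -/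
lemma eq_zero_of_comp_mulLeft_eq_zero [FiniteDimensional ℂ H] {Sinv : H →ₗ[ℂ] H}
    (hSinv₁ : ∀ x : H, Sinv (antipode ℂ x) = x) (hSinv₂ : ∀ x : H, antipode ℂ (Sinv x) = x)
    (hμ0 : μl ≠ 0) (hμ : ∀ x : H, slice μl (comul (R := ℂ) x) = μl x • 1) {a : H}
    (ha : μl ∘ₗ LinearMap.mulLeft ℂ a = 0) : a = 0 := by
  have sum_eq {a : H} (ha : μl ∘ₗ LinearMap.mulLeft ℂ a = 0) (x : H) :
      ∑ i ∈ (ℛ ℂ a).index, μl ((ℛ ℂ a).right i * x) • (ℛ ℂ a).left i = 0 := by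
    have h := congr(Sinv $(slice_comp_mulLeft_comul hμ a x))
    simp only [ha, map_zero, LinearMap.zero_apply, map_sum, map_smul, hSinv₁] at h
    exact h.symm
  have counit_eq {a : H} (ha : μl ∘ₗ LinearMap.mulLeft ℂ a = 0) : counit (R := ℂ) a = 0 := by
    obtain ⟨x, hx⟩ : ∃ x, μl x ≠ 0 := by
      by_contra! h
      exact hμ0 (LinearMap.ext h)
    let e := Module.finBasis ℂ H
    have h : μl (∑ i ∈ (ℛ ℂ a).index, (ℛ ℂ a).right i * (Sinv ((ℛ ℂ a).left i) * x)) = 0 := by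
      calc
        _ = ∑ k, e.coord k ((Sinv (∑ i ∈ (ℛ ℂ a).index,
            μl ((ℛ ℂ a).right i * e k) • (ℛ ℂ a).left i)) * x) := by
          simp only [map_sum, Finset.sum_mul, map_smul, smul_mul_assoc]
          rw [Finset.sum_comm]
          refine Finset.sum_congr rfl fun i _ => ?_
          have h := congr(μl ((ℛ ℂ a).right i * $(e.sum_repr (Sinv ((ℛ ℂ a).left i) * x))))
          simp only [Finset.mul_sum, map_sum, mul_smul_comm, map_smul] at h
          rw [← h]
          simp [mul_comm]
        _ = 0 := by simp [sum_eq ha]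
    have hS := mul_lTensor_comm_comul hSinv₁ hSinv₂ a
    rw [← (ℛ ℂ a).eq] at hS
    simp only [map_sum, TensorProduct.comm_tmul, LinearMap.lTensor_tmul,
      LinearMap.mul'_apply] at hS
    simp only [← mul_assoc, ← Finset.sum_mul, hS] at h
    simpa [hx] using h
  refine (Module.forall_dual_apply_eq_zero_iff ℂ a).1 fun f => ?_
  have hf : counit (R := ℂ) (∑ i ∈ (ℛ ℂ a).index, f ((ℛ ℂ a).left i) • (ℛ ℂ a).right i) = 0 := by
    refine counit_eq (LinearMap.ext fun x => ?_)
    have h := congr(f $(sum_eq ha x))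
    simpa [Finset.sum_mul, mul_comm] using h
  rw [← sum_counit_right_smul a]
  simpa [mul_comm] using hf

lemma surjective_comp_mulLeft [FiniteDimensional ℂ H] {Sinv : H →ₗ[ℂ] H}
    (hSinv₁ : ∀ x : H, Sinv (antipode ℂ x) = x) (hSinv₂ : ∀ x : H, antipode ℂ (Sinv x) = x)
    (hμ0 : μl ≠ 0) (hμ : ∀ x : H, slice μl (comul (R := ℂ) x) = μl x • 1) :
    Function.Surjective fun a : H => μl ∘ₗ LinearMap.mulLeft ℂ a := by
  let F : H →ₗ[ℂ] Module.Dual ℂ H := (LinearMap.mul ℂ H).compr₂ μl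
  have hF (a : H) : F a = μl ∘ₗ LinearMap.mulLeft ℂ a := rfl
  refine (LinearMap.injective_iff_surjective_of_finrank_eq_finrank
    (f := F) Subspace.dual_finrank_eq.symm).1 ?_
  refine (injective_iff_map_eq_zero F).2 fun a ha => ?_
  exact eq_zero_of_comp_mulLeft_eq_zero hSinv₁ hSinv₂ hμ0 hμ (hF a ▸ ha)

lemma slice_rTensor (f : Module.Dual ℂ H) (P : H →ₗ[ℂ] H) (t : H ⊗[ℂ] H) :
    slice f (LinearMap.rTensor H P t) = P (slice f t) := by
  induction t with
  | zero => simp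
  | tmul x y => simp
  | add x y hx hy => simp only [map_add, hx, hy]

lemma bijective_convLeft [FiniteDimensional ℂ H] {Sinv : H →ₗ[ℂ] H}
    (hSinv₁ : ∀ x : H, Sinv (antipode ℂ x) = x) (hSinv₂ : ∀ x : H, antipode ℂ (Sinv x) = x)
    (hμ0 : μl ≠ 0) (hμ : ∀ x : H, slice μl (comul (R := ℂ) x) = μl x • 1)
    {φ : Module.Dual ℂ H} (hφ : Function.Surjective (antipodeContract φ)) :
    Function.Bijective (convLeft φ) := by
  have hs : Function.Surjective (convLeft φ) := fun ψ => by
    obtain ⟨b, rfl⟩ := surjective_comp_mulLeft hSinv₁ hSinv₂ hμ0 hμ ψ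
    obtain ⟨a, rfl⟩ := hφ b
    exact ⟨_, conv_comp_mulLeft_right hμ φ a⟩
  exact ⟨LinearMap.injective_iff_surjective.2 hs, hs⟩

end

section

variable {H : Type} [Ring H] [HopfAlgebra ℂ H] {ι : Type} [Fintype ι] {aR bR : ι → H}

lemma monodromy_eq_sum :
    ((∑ i, bR i ⊗ₜ[ℂ] aR i) * ∑ i, aR i ⊗ₜ[ℂ] bR i : H ⊗[ℂ] H) =
      ∑ i, ∑ j, (bR i * aR j) ⊗ₜ[ℂ] (aR i * bR j) := by
  simp only [Finset.sum_mul_sum, Algebra.TensorProduct.tmul_mul_tmul]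

lemma rTensor_comul_monodromy
    (hR₁ : (∑ i, (comul (R := ℂ) (aR i)) ⊗ₜ[ℂ] bR i)
        = ∑ i, ∑ j, (aR i ⊗ₜ[ℂ] aR j) ⊗ₜ[ℂ] (bR i * bR j))
    (hR₂ : (∑ i, aR i ⊗ₜ[ℂ] (comul (R := ℂ) (bR i)))
        = ∑ i, ∑ j, (aR i * aR j) ⊗ₜ[ℂ] (bR j ⊗ₜ[ℂ] bR i)) :
    LinearMap.rTensor H comul
      ((∑ i, bR i ⊗ₜ[ℂ] aR i) * ∑ i, aR i ⊗ₜ[ℂ] bR i : H ⊗[ℂ] H) =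
      ∑ i, ∑ l, ∑ j, ∑ k, ((bR j * aR k) ⊗ₜ[ℂ] (bR i * aR l)) ⊗ₜ[ℂ]
        (aR i * (aR j * bR k) * bR l) := by
  have h₂ := congr(TensorProduct.comm ℂ _ _ $hR₂)
  simp only [map_sum, TensorProduct.comm_tmul] at h₂
  have h := congr($h₂ * $hR₁)
  simp only [Finset.sum_mul_sum, Algebra.TensorProduct.tmul_mul_tmul,
    ← Bialgebra.comul_mul] at h
  rw [monodromy_eq_sum]
  simp only [map_sum, LinearMap.rTensor_tmul, h, mul_assoc]
  refine Finset.sum_congr rfl fun i _ => ?_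
  rw [Finset.sum_comm]
  conv_rhs => rw [Finset.sum_comm]
  exact Finset.sum_congr rfl fun j _ => Finset.sum_comm

lemma rTensor_antipodeContract_monodromy
    (hR₁ : (∑ i, (comul (R := ℂ) (aR i)) ⊗ₜ[ℂ] bR i)
        = ∑ i, ∑ j, (aR i ⊗ₜ[ℂ] aR j) ⊗ₜ[ℂ] (bR i * bR j))
    (hR₂ : (∑ i, aR i ⊗ₜ[ℂ] (comul (R := ℂ) (bR i)))
        = ∑ i, ∑ j, (aR i * aR j) ⊗ₜ[ℂ] (bR j ⊗ₜ[ℂ] bR i))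
    {φ : Module.Dual ℂ H} {w : H} (hw : ∀ x : H, w * x = x * w)
    (hφ : ∑ i, ∑ j, φ (antipode ℂ (bR i * aR j)) • (aR i * bR j) = w) :
    LinearMap.rTensor H (antipodeContract φ)
      ((∑ i, bR i ⊗ₜ[ℂ] aR i) * ∑ i, aR i ⊗ₜ[ℂ] bR i : H ⊗[ℂ] H) =
      (1 ⊗ₜ[ℂ] w) * ((∑ i, bR i ⊗ₜ[ℂ] aR i) * ∑ i, aR i ⊗ₜ[ℂ] bR i) := by
  have h : antipodeContract φ = ((TensorProduct.lid ℂ H).toLinearMap ∘ₗ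
    LinearMap.rTensor H (φ ∘ₗ antipode ℂ)) ∘ₗ comul (R := ℂ) := rfl
  rw [h, LinearMap.rTensor_comp_apply, rTensor_comul_monodromy hR₁ hR₂, monodromy_eq_sum]
  simp only [map_sum, LinearMap.rTensor_tmul, LinearMap.comp_apply, LinearEquiv.coe_coe,
    TensorProduct.lid_tmul, TensorProduct.smul_tmul, Finset.mul_sum,
    Algebra.TensorProduct.tmul_mul_tmul, one_mul, ← TensorProduct.tmul_sum]
  refine Finset.sum_congr rfl fun i _ => Finset.sum_congr rfl fun l _ => ?_
  congr 1
  rw [← mul_assoc, hw (aR i), ← hφ]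
  simp only [Finset.mul_sum, Finset.sum_mul, mul_smul_comm, smul_mul_assoc]

end

section

variable {H : Type} [Ring H] [HopfAlgebra ℂ H]

/-- The braid relation for `T_a` and the operator `φ ↦ c μ(v?) * φ`. -/
lemma braid_comp_mulLeft_conv {X : H ⊗[ℂ] H} {v vinv : H} (hv : v * vinv = 1)
    (hX : comul (R := ℂ) vinv = (vinv ⊗ₜ[ℂ] vinv) * X)
    {μl : Module.Dual ℂ H} (hμ : ∀ x : H, slice μl (comul (R := ℂ) x) = μl x • 1)
    (hPX : LinearMap.rTensor H (antipodeContract (μl ∘ₗ LinearMap.mulLeft ℂ v)) X =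
      μl v • ((1 ⊗ₜ[ℂ] vinv) * X)) (φ : Module.Dual ℂ H) :
    conv (μl ∘ₗ LinearMap.mulLeft ℂ v)
        (conv (μl ∘ₗ LinearMap.mulLeft ℂ v) φ ∘ₗ LinearMap.mulLeft ℂ vinv) =
      μl v • (conv (μl ∘ₗ LinearMap.mulLeft ℂ v)
        (φ ∘ₗ LinearMap.mulLeft ℂ vinv) ∘ₗ LinearMap.mulLeft ℂ vinv) := by
  have hcomp : (μl ∘ₗ LinearMap.mulLeft ℂ v) ∘ₗ LinearMap.mulLeft ℂ vinv = μl := by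
    ext x; simp [← mul_assoc, hv]
  rw [conv_comp_mulLeft hX, conv_comp_mulLeft hX, convWith_tmul_mul, convWith_tmul_mul,
    hcomp, conv_convWith hμ, hPX, convWith_smul, convWith_tmul_mul, LinearMap.mulLeft_one,
    LinearMap.comp_id]

/-- A grouplike `g` conjugates convolution by `φ(g⁻¹ ?)` to convolution by `φ`. -/
lemma conv_comp_mulLeft_grouplike {g gi : H} (hgi : gi * g = 1)
    (hg : comul (R := ℂ) g = g ⊗ₜ[ℂ] g) (φ ψ : Module.Dual ℂ H) :
    conv (φ ∘ₗ LinearMap.mulLeft ℂ gi) ψ ∘ₗ LinearMap.mulLeft ℂ g =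
      conv φ (ψ ∘ₗ LinearMap.mulLeft ℂ g) := by
  rw [conv_comp_mulLeft hg, ← mul_one (g ⊗ₜ[ℂ] g), convWith_tmul_mul, convWith_one]
  congr 1
  ext x
  simp [← mul_assoc, hgi]

end

section

variable {H : Type} [Ring H] [HopfAlgebra ℂ H]

lemma Tb_comp_mulLeft {v vinv g gi : H} {μl : Module.Dual ℂ H}
    (hvcentral : ∀ x : H, v * x = x * v)
    (hvinvcentral : ∀ x : H, vinv * x = x * vinv) (hgi₂ : gi * g = 1)
    (hg : comul (R := ℂ) g = g ⊗ₜ[ℂ] g) (φ : Module.Dual ℂ H) :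
    Tb μl v vinv gi φ ∘ₗ LinearMap.mulLeft ℂ g =
      (μl v)⁻¹ • (conv (μl ∘ₗ LinearMap.mulLeft ℂ v)
        ((φ ∘ₗ LinearMap.mulLeft ℂ g) ∘ₗ LinearMap.mulLeft ℂ v) ∘ₗ LinearMap.mulLeft ℂ vinv) := by
  have h₁ : LinearMap.mulLeft ℂ vinv ∘ₗ LinearMap.mulLeft ℂ g =
      LinearMap.mulLeft ℂ g ∘ₗ LinearMap.mulLeft ℂ vinv := by
    ext x; simp [← mul_assoc, hvinvcentral g]
  have h₂ : LinearMap.mulLeft ℂ v ∘ₗ LinearMap.mulLeft ℂ g =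
      LinearMap.mulLeft ℂ g ∘ₗ LinearMap.mulLeft ℂ v := by
    ext x; simp [← mul_assoc, hvcentral g]
  have h₃ : μl ∘ₗ LinearMap.mulLeft ℂ (gi * v) =
      (μl ∘ₗ LinearMap.mulLeft ℂ v) ∘ₗ LinearMap.mulLeft ℂ gi := by
    rw [← hvcentral, LinearMap.mulLeft_mul, LinearMap.comp_assoc]
  rw [Tb, h₃, LinearMap.smul_comp, LinearMap.comp_assoc, h₁, ← LinearMap.comp_assoc,
    conv_comp_mulLeft_grouplike hgi₂ hg, LinearMap.comp_assoc, h₂, LinearMap.comp_assoc]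

lemma bijective_comp_mulLeft {a b : H} (hab : a * b = 1) (hba : b * a = 1) :
    Function.Bijective fun φ : Module.Dual ℂ H => φ ∘ₗ LinearMap.mulLeft ℂ a :=
  Function.bijective_iff_has_inverse.2 ⟨fun φ => φ ∘ₗ LinearMap.mulLeft ℂ b,
    fun φ => by ext x; simp [← mul_assoc, hab], fun φ => by ext x; simp [← mul_assoc, hba]⟩

end

theorem braid_relation_Ta_Tb
    {H : Type} [Ring H] [HopfAlgebra ℂ H] [FiniteDimensional ℂ H]
    -- the antipode is invertible
    (Sinv : H →ₗ[ℂ] H)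
    (hSinv₁ : ∀ x : H, Sinv (HopfAlgebra.antipode (R := ℂ) x) = x)
    (hSinv₂ : ∀ x : H, HopfAlgebra.antipode (R := ℂ) (Sinv x) = x)
    -- an invertible R-matrix `R = Σᵢ aᵢ ⊗ bᵢ`
    {ι : Type} [Fintype ι] (aR bR : ι → H)
    (hRinv : IsUnit (∑ i, aR i ⊗ₜ[ℂ] bR i : H ⊗[ℂ] H))
    -- `R Δ(x) = Δᵒᵖ(x) R`
    (hRΔ : ∀ x : H,
      (∑ i, aR i ⊗ₜ[ℂ] bR i) * Coalgebra.comul (R := ℂ) x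
        = (TensorProduct.comm ℂ H H) (Coalgebra.comul (R := ℂ) x)
            * ∑ i, aR i ⊗ₜ[ℂ] bR i)
    -- `(Δ ⊗ id)(R) = R₁₃ R₂₃`
    (hR₁ : (∑ i, (Coalgebra.comul (R := ℂ) (aR i)) ⊗ₜ[ℂ] bR i)
        = ∑ i, ∑ j, (aR i ⊗ₜ[ℂ] aR j) ⊗ₜ[ℂ] (bR i * bR j))
    -- `(id ⊗ Δ)(R) = R₁₃ R₁₂`
    (hR₂ : (∑ i, aR i ⊗ₜ[ℂ] (Coalgebra.comul (R := ℂ) (bR i)))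
        = ∑ i, ∑ j, (aR i * aR j) ⊗ₜ[ℂ] (bR j ⊗ₜ[ℂ] bR i))
    -- a ribbon element `v`
    (v vinv : H) (hv₁ : v * vinv = 1) (hv₂ : vinv * v = 1)
    (hvcentral : ∀ x : H, v * x = x * v)
    (hSv : HopfAlgebra.antipode (R := ℂ) v = v)
    (hεv : Coalgebra.counit (R := ℂ) v = 1)
    -- `Δ(v) = (R'R)⁻¹ (v ⊗ v)`, i.e. `R' R Δ(v) = v ⊗ v`
    (hΔv : (∑ i, bR i ⊗ₜ[ℂ] aR i) * ((∑ i, aR i ⊗ₜ[ℂ] bR i)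
            * Coalgebra.comul (R := ℂ) v) = v ⊗ₜ[ℂ] v)
    -- factorizability: `β ↦ (β ⊗ id)(RR')` is bijective
    (hfact : Function.Bijective fun β : Module.Dual ℂ H =>
        ∑ i, ∑ j, β (aR i * bR j) • (bR i * aR j))
    -- the pivotal element `g = u v⁻¹`, where `u = Σᵢ S(bᵢ) aᵢ` is the Drinfeld element;
    -- `g` is invertible, grouplike and implements `S²`
    (g gi : H)
    (hg : g = (∑ i, HopfAlgebra.antipode (R := ℂ) (bR i) * aR i) * vinv)
    (hgi₁ : g * gi = 1) (hgi₂ : gi * g = 1)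
    (hggrouplike : Coalgebra.comul (R := ℂ) g = g ⊗ₜ[ℂ] g)
    (hgS₂ : ∀ x : H,
      HopfAlgebra.antipode (R := ℂ) (HopfAlgebra.antipode (R := ℂ) x) * g = g * x)
    -- a left integral `μˡ`, with `μˡ(v) ≠ 0` and `μˡ(v⁻¹) ≠ 0`
    (μl : Module.Dual ℂ H) (hμl0 : μl ≠ 0)
    (hμl : ∀ x : H, (TensorProduct.rid ℂ H)
        ((LinearMap.lTensor H μl) (Coalgebra.comul (R := ℂ) x)) = μl x • (1 : H))
    (hμlv : μl v ≠ 0) (hμlvinv : μl vinv ≠ 0)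
    :
    Function.Bijective (Ta (H := H) vinv)
    ∧ Function.Bijective (Tb μl v vinv gi)
    ∧ Ta vinv ∘ Tb μl v vinv gi ∘ Ta vinv = Tb μl v vinv gi ∘ Ta vinv ∘ Tb μl v vinv gi := by
  have hvinvcentral (x : H) : vinv * x = x * vinv :=
    calc vinv * x = vinv * (x * v) * vinv := by simp only [mul_assoc, hv₁, mul_one]
      _ = x * vinv := by rw [← hvcentral, ← mul_assoc, hv₂, one_mul]
  have hμ (x : H) : slice μl (comul (R := ℂ) x) = μl x • 1 := hμl x
  set X : H ⊗[ℂ] H := (∑ i, bR i ⊗ₜ[ℂ] aR i) * ∑ i, aR i ⊗ₜ[ℂ] bR i with hX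
  have hslice (β : Module.Dual ℂ H) :
      ∑ i, ∑ j, β (aR i * bR j) • (bR i * aR j) = slice β X := by
    simp [hX, monodromy_eq_sum]
  simp only [hslice] at hfact
  have hXv : X = (v ⊗ₜ[ℂ] v) * comul (R := ℂ) vinv := by
    rw [← hΔv, ← mul_assoc, mul_assoc, ← Bialgebra.comul_mul, hv₁, Bialgebra.comul_one, mul_one]
  have hXvinv : comul (R := ℂ) vinv = (vinv ⊗ₜ[ℂ] vinv) * X := by
    rw [hXv, ← mul_assoc, Algebra.TensorProduct.tmul_mul_tmul, hv₂,
      ← Algebra.TensorProduct.one_def, one_mul]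
  have hcomp : (μl ∘ₗ LinearMap.mulLeft ℂ vinv) ∘ₗ LinearMap.mulLeft ℂ v = μl := by
    ext x; simp [← mul_assoc, hv₂]
  have hcyc (x y : H) : μl (x * y) = μl (y * antipode ℂ (antipode ℂ x)) := by
    have h := apply_mul_eq_apply_mul_antipode_antipode X (monodromy_mul_comul hRΔ) hfact.1
      (μl ∘ₗ LinearMap.mulLeft ℂ vinv) (fun h => by
        rw [hXv, slice_mul_left, hcomp, hμ, mul_smul_comm, mul_one, mul_smul_comm,
          smul_mul_assoc, hvcentral]) x (v * y)
    simp only [LinearMap.comp_apply, LinearMap.mulLeft_apply] at h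
    rw [← mul_assoc x, ← hvcentral x] at h
    simpa only [← mul_assoc, hv₂, one_mul] using h
  have hPX : LinearMap.rTensor H (antipodeContract (μl ∘ₗ LinearMap.mulLeft ℂ v)) X =
      μl v • ((1 ⊗ₜ[ℂ] vinv) * X) := by
    have h := rTensor_antipodeContract_monodromy hR₁ hR₂
      (φ := μl ∘ₗ LinearMap.mulLeft ℂ v) (w := μl v • vinv)
      (fun x => by rw [smul_mul_assoc, hvinvcentral, mul_smul_comm])
      (sum_apply_antipode_monodromy hSinv₁ hSinv₂ hRinv hR₁ hR₂ hv₁ hvcentral hΔv (hμ v) hcyc)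
    rw [h, TensorProduct.tmul_smul, Algebra.smul_mul_assoc]
  have hsurj : Function.Surjective (antipodeContract (μl ∘ₗ LinearMap.mulLeft ℂ v)) := by
    intro b
    obtain ⟨β, rfl⟩ := hfact.2 b
    refine ⟨(μl v)⁻¹ • slice (β ∘ₗ LinearMap.mulLeft ℂ v) X, ?_⟩
    rw [map_smul, ← slice_rTensor, hPX, map_smul, slice_mul_left, one_mul, smul_smul,
      inv_mul_cancel₀ hμlv, one_smul, LinearMap.comp_assoc, ← LinearMap.mulLeft_mul, hv₁,
      LinearMap.mulLeft_one, LinearMap.comp_id]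
  have hQ := bijective_convLeft hSinv₁ hSinv₂ hμl0 hμ hsurj
  have hA : Function.Bijective (Ta (H := H) vinv) := bijective_comp_mulLeft hv₂ hv₁
  have hV : Function.Bijective (Ta (H := H) v) := bijective_comp_mulLeft hv₁ hv₂
  have hG : Function.Bijective (Ta (H := H) g) := bijective_comp_mulLeft hgi₁ hgi₂
  have hTb (φ : Module.Dual ℂ H) : Ta g (Tb μl v vinv gi φ) = (μl v)⁻¹ •
      Ta vinv (convLeft (μl ∘ₗ LinearMap.mulLeft ℂ v) (Ta v (Ta g φ))) :=
    Tb_comp_mulLeft hvcentral hvinvcentral hgi₂ hggrouplike φ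
  have hAV (φ : Module.Dual ℂ H) : Ta v (Ta vinv φ) = φ := by
    ext x; simp [Ta, ← mul_assoc, hv₂]
  have hGA (φ : Module.Dual ℂ H) : Ta g (Ta vinv φ) = Ta vinv (Ta g φ) := by
    ext x; simp [Ta, ← mul_assoc, hvinvcentral g]
  have hsmul (a : H) (c : ℂ) (φ : Module.Dual ℂ H) : Ta a (c • φ) = c • Ta a φ := rfl
  refine ⟨hA, ?_, ?_⟩
  · refine (Function.Bijective.of_comp_iff' hG _).1 ?_
    have h : Ta g ∘ Tb μl v vinv gi = (fun φ => (μl v)⁻¹ • φ) ∘ Ta vinv ∘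
        convLeft (μl ∘ₗ LinearMap.mulLeft ℂ v) ∘ Ta v ∘ Ta g := funext hTb
    rw [h]
    exact (MulAction.bijective₀ (inv_ne_zero hμlv)).comp (hA.comp (hQ.comp (hV.comp hG)))
  · funext φ
    refine hG.1 ?_
    have hbraid := braid_comp_mulLeft_conv hv₁ hXvinv hμ hPX (Ta v (Ta g φ))
    change convLeft (μl ∘ₗ LinearMap.mulLeft ℂ v) (Ta vinv (convLeft _ _)) =
      μl v • Ta vinv (convLeft _ (Ta vinv _)) at hbraid
    have hVA : Ta vinv (Ta v (Ta g φ)) = Ta g φ := by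
      ext x; simp [Ta, ← mul_assoc, hv₁]
    simp only [Function.comp_apply, hTb, hGA, hAV, hsmul, map_smul, hbraid, hVA,
      smul_smul, inv_mul_cancel₀ hμlv, one_smul]

end
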